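/- Let L and M be the kernels of the inflation maps H²(H/A, D) → H²(H/Z, D) and H²(K/A, D) → H²(K/Z, D) respectively, so that L ≅ Hom((A ∩ [H,H])/Z, D) and M ≅ Hom((A ∩ [K,K])/Z, D). Then Hom(Z, D) embeds into (H²(H/A, D)/L) ⊕ (H²(K/A, D)/M); equivalently, Hom(Z, D) embeds into Im(inf : H²(H/A, D) → H²(H/Z, D)) ⊕ Im(inf : H²(K/A, D) → H²(K/Z, D)). -/

import Mathlib

/-!
Setting (central products): `G` is a group with normal subgroups `H` and `K` such that
`G = HK` (i.e. `H ⊔ K = ⊤`) and `[H, K] = 1` (i.e. every element of `H` commutes with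
every element of `K`).  We set `A = H ⊓ K` and `Z = ⁅H,H⁆ ⊓ ⁅K,K⁆`; both are central
in `G`.  Coefficients are taken in a divisible abelian group `D`, regarded as a trivial
module.  Second cohomology `H2 X D` is realized concretely as (inhomogeneous)
2-cocycles modulo 2-coboundaries, and `Hom(X, D)` is realized as `Additive X →+ D`.
-/

open scoped TensorProduct

set_option maxHeartbeats 1000000
set_option synthInstance.maxHeartbeats 1000000
set_option synthInstance.maxSize 2000

namespace SchurCP

variable (G : Type) [Group G] (D : Type) [AddCommGroup D]

/-- The group of 2-cocycles on `G` with values in the trivial module `D`. -/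
def cocycles2 : AddSubgroup (G → G → D) where
  carrier := {f | ∀ g h k : G, f g h + f (g * h) k = f h k + f g (h * k)}
  zero_mem' := by intro g h k; simp
  add_mem' := by
    intro a b ha hb g h k
    simp only [Pi.add_apply]
    rw [add_add_add_comm, ha g h k, hb g h k, add_add_add_comm]
  neg_mem' := by
    intro a ha g h k
    simp only [Pi.neg_apply]
    rw [← neg_add, ← neg_add, ha g h k]

/-- The group of 2-coboundaries on `G` with values in the trivial module `D`. -/
def coboundaries2 : AddSubgroup (G → G → D) where
  carrier := {f | ∃ φ : G → D, ∀ g h : G, f g h = φ g + φ h - φ (g * h)}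
  zero_mem' := ⟨0, by simp⟩
  add_mem' := by
    rintro a b ⟨φ, hφ⟩ ⟨ψ, hψ⟩
    exact ⟨φ + ψ, fun g h => by simp only [Pi.add_apply, hφ g h, hψ g h]; abel⟩
  neg_mem' := by
    rintro a ⟨φ, hφ⟩
    exact ⟨-φ, fun g h => by simp only [Pi.neg_apply, hφ g h]; abel⟩

/-- The second cohomology group `H²(G, D)` of `G` with coefficients in the
trivial module `D`. -/
def H2 : Type := cocycles2 G D ⧸ (coboundaries2 G D).addSubgroupOf (cocycles2 G D)

instance : AddCommGroup (H2 G D) :=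
  QuotientAddGroup.Quotient.addCommGroup ((coboundaries2 G D).addSubgroupOf (cocycles2 G D))

variable {G D}

/-- The cohomology class of a 2-cocycle. -/
abbrev H2mk (f : cocycles2 G D) : H2 G D := QuotientAddGroup.mk f

/-- Pullback of a 2-cocycle along a group homomorphism. -/
def pullCocycle {G' : Type} [Group G'] (π : G' →* G) :
    cocycles2 G D →+ cocycles2 G' D where
  toFun f := ⟨fun x y => (f : G → G → D) (π x) (π y), by
    intro x y z
    simpa only [map_mul] using f.2 (π x) (π y) (π z)⟩
  map_zero' := rfl
  map_add' _ _ := rfl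

/-- The homomorphism `H²(G, D) → H²(G', D)` induced by a group homomorphism
`π : G' → G`; this specializes to restriction maps (for inclusions of subgroups)
and to inflation maps (for quotient maps). -/
def H2Map {G' : Type} [Group G'] (π : G' →* G) : H2 G D →+ H2 G' D :=
  QuotientAddGroup.map _ _ (pullCocycle π) (by
    intro f hf
    rw [AddSubgroup.mem_addSubgroupOf] at hf
    rw [AddSubgroup.mem_comap, AddSubgroup.mem_addSubgroupOf]
    obtain ⟨φ, hφ⟩ := hf
    exact ⟨fun x => φ (π x), fun x y => by
      show (f : G → G → D) (π x) (π y) = _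
      rw [hφ (π x) (π y), ← map_mul]⟩)

theorem commutator_le_self {X : Type} [Group X] (H : Subgroup X) : ⁅H, H⁆ ≤ H := by
  rw [Subgroup.commutator_le]
  intro g₁ h₁ g₂ h₂
  rw [commutatorElement_def]
  exact H.mul_mem (H.mul_mem (H.mul_mem h₁ h₂) (H.inv_mem h₁)) (H.inv_mem h₂)

theorem inf_commutator_le_inf {X : Type} [Group X] (H K : Subgroup X) :
    ⁅H, H⁆ ⊓ ⁅K, K⁆ ≤ H ⊓ K :=
  inf_le_inf (commutator_le_self H) (commutator_le_self K)

theorem subgroupOf_le {X : Type} [Group X] {B C : Subgroup X} (h : B ≤ C)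
    (J : Subgroup X) : B.subgroupOf J ≤ C.subgroupOf J := fun _x hx => h hx

/-- The natural projection `X/N → X/M` for `N ≤ M`. -/
def quotProj {X : Type} [Group X] {N M : Subgroup X} [N.Normal] [M.Normal] (h : N ≤ M) :
    (X ⧸ N) →* (X ⧸ M) :=
  QuotientGroup.map N M (MonoidHom.id X) (by rwa [Subgroup.comap_id])

/-- The inflation homomorphism `H²(X/M, D) → H²(X/N, D)` for `N ≤ M`. -/
def inflMap {X : Type} [Group X] {N M : Subgroup X} [N.Normal] [M.Normal]
    (h : N ≤ M) (D : Type) [AddCommGroup D] : H2 (X ⧸ M) D →+ H2 (X ⧸ N) D :=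
  H2Map (quotProj h)

/-- The natural homomorphism `H/(A ∩ H) → X/A` for subgroups `A, H` of `X`;
for `A ≤ H` this realizes `H/A` as a subgroup of `X/A`. -/
def quotInclusion {X : Type} [Group X] (H A : Subgroup X) [A.Normal]
    [(A.subgroupOf H).Normal] : (↥H ⧸ A.subgroupOf H) →* X ⧸ A :=
  QuotientGroup.map (A.subgroupOf H) A H.subtype (fun _x hx => hx)

/-- The abelian tensor product `X ⊗ Y = X/[X,X] ⊗_ℤ Y/[Y,Y]` of two groups. -/
abbrev AbTensor (X Y : Type) [Group X] [Group Y] : Type :=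
  TensorProduct ℤ (Additive (Abelianization X)) (Additive (Abelianization Y))

/-- The element `x[X,X] ⊗ y[Y,Y]` of the abelian tensor product. -/
noncomputable abbrev tmulAb {X Y : Type} [Group X] [Group Y] (x : X) (y : Y) :
    AbTensor X Y :=
  Additive.ofMul (Abelianization.of x) ⊗ₜ[ℤ] Additive.ofMul (Abelianization.of y)

/-- The map on abelian tensor products induced by a pair of group homomorphisms. -/
noncomputable def abTensorMap {X Y X' Y' : Type} [Group X] [Group Y] [Group X'] [Group Y']
    (f : X →* X') (g : Y →* Y') : AbTensor X Y →ₗ[ℤ] AbTensor X' Y' :=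
  TensorProduct.map (MonoidHom.toAdditive (Abelianization.map f)).toIntLinearMap
    (MonoidHom.toAdditive (Abelianization.map g)).toIntLinearMap

section Transgression

variable {X : Type} [Group X] (M : Subgroup X) [M.Normal]

/-- The element `x * s(xM)⁻¹` of `M`, where `s : X ⧸ M → X` is the chosen section. -/
noncomputable def sectionDefect (x : X) : M :=
  ⟨x * (Quotient.out (x : X ⧸ M))⁻¹, by
    have h : ((Quotient.out (x : X ⧸ M) : X) : X ⧸ M) = x := Quotient.out_eq' _
    rw [← QuotientGroup.eq_one_iff, QuotientGroup.mk_mul, QuotientGroup.mk_inv, h, mul_inv_cancel]⟩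

variable {M}

theorem sectionDefect_mul_mem (hM : M ≤ Subgroup.center X) (x : X) (m : M) :
    sectionDefect M (x * m) = sectionDefect M x * m := by
  have h : ((x * m : X) : X ⧸ M) = x := by
    rw [QuotientGroup.mk_mul, (QuotientGroup.eq_one_iff (m : X)).2 m.2, mul_one]
  ext
  simp only [sectionDefect, h, Subgroup.coe_mul]
  rw [mul_assoc, mul_assoc, Subgroup.mem_center_iff.1 (hM m.2)]

theorem sectionDefect_mul (hM : M ≤ Subgroup.center X) (x y : X) :
    sectionDefect M (x * y) = sectionDefect M x * sectionDefect M y *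
      sectionDefect M (Quotient.out (x : X ⧸ M) * Quotient.out (y : X ⧸ M)) := by
  have hc := fun z (m : M) => Subgroup.mem_center_iff.1 (hM m.2) z
  have hs : ∀ x : X, Quotient.out (x : X ⧸ M) * (sectionDefect M x : X) = x := fun x => by
    rw [hc]; simp [sectionDefect]
  have hxy : x * y = Quotient.out (x : X ⧸ M) * Quotient.out (y : X ⧸ M) *
      ((sectionDefect M x * sectionDefect M y : M) : X) := by
    conv_lhs => rw [← hs x, ← hs y]
    rw [Subgroup.coe_mul, mul_assoc, mul_assoc, ← mul_assoc (sectionDefect M x : X),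
      ← hc _ (sectionDefect M x), mul_assoc]
  conv_lhs => rw [hxy, sectionDefect_mul_mem hM]
  ext
  simp only [Subgroup.coe_mul]
  exact hc _ (sectionDefect M x * sectionDefect M y)

/-- The transgressed cocycle pulls back to minus the coboundary of `θ ∘ sectionDefect`. -/
theorem map_sectionDefect_mul (hM : M ≤ Subgroup.center X) (θ : Additive M →+ D) (x y : X) :
    θ (.ofMul (sectionDefect M
      (Quotient.out (x : X ⧸ M) * Quotient.out (y : X ⧸ M)))) =
    θ (.ofMul (sectionDefect M (x * y))) - θ (.ofMul (sectionDefect M x)) -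
      θ (.ofMul (sectionDefect M y)) := by
  rw [sectionDefect_mul hM x y]
  simp only [ofMul_mul, map_add]
  abel

/-- The cocycle on `X ⧸ M` obtained by pushing the class of the central extension
`1 → M → X → X ⧸ M → 1` forward along a homomorphism `M → D`. -/
noncomputable def transgressionCocycle (hM : M ≤ Subgroup.center X) :
    (Additive M →+ D) →+ cocycles2 (X ⧸ M) D where
  toFun θ := ⟨fun p q => θ (.ofMul (sectionDefect M (Quotient.out p * Quotient.out q))), by
    intro p q r
    induction p using QuotientGroup.induction_on with | H x => ?_
    induction q using QuotientGroup.induction_on with | H y => ?_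
    induction r using QuotientGroup.induction_on with | H z => ?_
    rw [← QuotientGroup.mk_mul, ← QuotientGroup.mk_mul]
    simp only [map_sectionDefect_mul hM, mul_assoc]
    abel⟩
  map_zero' := rfl
  map_add' _ _ := rfl

/-- The transgression map `Hom(M, D) → H²(X/M, D)` of a central subgroup `M`. -/
noncomputable def transgression (hM : M ≤ Subgroup.center X) :
    (Additive M →+ D) →+ H2 (X ⧸ M) D :=
  (QuotientAddGroup.mk' _).comp (transgressionCocycle hM)

theorem transgressionCocycle_apply (hM : M ≤ Subgroup.center X) (θ : Additive M →+ D) (x y : X) :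
    (transgressionCocycle hM θ : X ⧸ M → X ⧸ M → D) x y =
      θ (.ofMul (sectionDefect M (x * y))) - θ (.ofMul (sectionDefect M x)) -
        θ (.ofMul (sectionDefect M y)) :=
  map_sectionDefect_mul hM θ x y

theorem H2mk_eq_zero_iff {Q : Type} [Group Q] (f : cocycles2 Q D) :
    H2mk f = 0 ↔ ∃ ψ : Q → D, ∀ p q, (f : Q → Q → D) p q = ψ p + ψ q - ψ (p * q) :=
  (QuotientAddGroup.eq_zero_iff f).trans AddSubgroup.mem_addSubgroupOf

theorem inflMap_H2mk_eq_zero_iff {N : Subgroup X} [N.Normal] (h : N ≤ M) (f : cocycles2 (X ⧸ M) D) :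
    inflMap h D (H2mk f) = 0 ↔ ∃ ψ : X ⧸ N → D, ∀ x y : X,
      (f : X ⧸ M → X ⧸ M → D) x y = ψ x + ψ y - ψ (x * y : X) := by
  refine (H2mk_eq_zero_iff (pullCocycle (quotProj h) f)).trans (exists_congr fun ψ => ?_)
  exact ⟨fun H x y => H x y, fun H p q => QuotientGroup.induction_on p fun x =>
    QuotientGroup.induction_on q fun y => H x y⟩

theorem inflMap_refl_apply (c : H2 (X ⧸ M) D) : inflMap (le_refl M) D c = c := by
  induction c using QuotientAddGroup.induction_on with | H f => ?_
  refine congrArg H2mk (Subtype.ext ?_)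
  funext p q
  induction p using QuotientGroup.induction_on with | H x => ?_
  induction q using QuotientGroup.induction_on with | H y => ?_
  rfl

/-- The inflation of `transgression θ` to `X ⧸ N` vanishes exactly when `θ` agrees on `N` with
a homomorphism defined on all of `X`. -/
theorem inflMap_transgression_eq_zero_iff {N : Subgroup X} [N.Normal] (h : N ≤ M)
    (hM : M ≤ Subgroup.center X) (θ : Additive M →+ D) :
    inflMap h D (transgression hM θ) = 0 ↔
      ∃ χ : Additive X →+ D, ∀ n (hn : n ∈ N), θ (.ofMul ⟨n, h hn⟩) = χ (.ofMul n) := by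
  refine (inflMap_H2mk_eq_zero_iff h (transgressionCocycle hM θ)).trans ?_
  simp only [transgressionCocycle_apply]
  set φ : X → D := fun x => θ (.ofMul (sectionDefect M x)) with hφ
  have hφm : ∀ x n (hn : n ∈ N), φ (x * n) = φ x + θ (.ofMul ⟨n, h hn⟩) := fun x n hn => by
    simp only [hφ]
    rw [sectionDefect_mul_mem hM x ⟨n, h hn⟩, ofMul_mul, map_add]
  constructor
  · rintro ⟨ψ, hψ⟩
    let χ : Additive X →+ D := AddMonoidHom.mk' (fun x => φ x.toMul + ψ (x.toMul : X)) (by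
      intro x y
      have := hψ x.toMul y.toMul
      rw [toMul_add, ← sub_eq_zero]
      rw [← sub_eq_zero] at this
      rw [← this]
      abel)
    refine ⟨χ, fun n hn => ?_⟩
    have h1 : φ 1 + ψ (1 : X) = 0 := χ.map_zero
    have hn1 : ((n : X) : X ⧸ N) = (1 : X) := (QuotientGroup.eq_one_iff n).2 hn
    have h2 := hφm 1 n hn
    rw [one_mul] at h2
    change _ = φ n + ψ n
    rw [hn1, h2, add_right_comm, h1, zero_add]
  · rintro ⟨χ, hχ⟩
    have hlift : ∀ x y : X, QuotientGroup.leftRel N x y →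
        χ (.ofMul x) - φ x = χ (.ofMul y) - φ y := by
      intro x y hxy
      obtain ⟨n, rfl⟩ : ∃ n, y = x * n := ⟨x⁻¹ * y, by group⟩
      have hn : n ∈ N := by simpa using QuotientGroup.leftRel_apply.1 hxy
      rw [hφm _ _ hn, hχ _ hn, ofMul_mul, map_add]
      abel
    refine ⟨Quotient.lift (fun x => χ (.ofMul x) - φ x) hlift, fun x y => ?_⟩
    change _ = (χ (.ofMul x) - φ x) + (χ (.ofMul y) - φ y) - (χ (.ofMul (x * y)) - φ (x * y))
    rw [ofMul_mul, map_add]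
    abel

/-- Every class in `H²(X/M, D)` that becomes trivial in `H²(X/N, D)` is transgressed from a
homomorphism on `M` vanishing on `N`. -/
theorem exists_transgression_eq {N : Subgroup X} [N.Normal] (h : N ≤ M)
    (hM : M ≤ Subgroup.center X) {c : H2 (X ⧸ M) D} (hc : inflMap h D c = 0) :
    ∃ θ : Additive M →+ D, (∀ n (hn : n ∈ N), θ (.ofMul ⟨n, h hn⟩) = 0) ∧
      transgression hM θ = c := by
  induction c using QuotientAddGroup.induction_on with | H f => ?_
  obtain ⟨ψ, hψ⟩ := (inflMap_H2mk_eq_zero_iff h f).1 hc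
  have hf1 : ∀ p, (f : X ⧸ M → X ⧸ M → D) p 1 = ψ (1 : X) := fun p => by
    have h1 := f.2 p 1 1
    have h2 := hψ 1 1
    simp only [mul_one, QuotientGroup.mk_one, add_sub_cancel_right] at h1 h2
    rw [add_right_cancel h1, h2, QuotientGroup.mk_one]
  have hψm : ∀ x (m : M), ψ (x * m : X) = ψ x + (ψ (m : X) - ψ (1 : X)) := fun x m => by
    have h1 := hψ x m
    rw [(QuotientGroup.eq_one_iff (m : X)).2 m.2, hf1] at h1
    rw [h1]; abel
  let θ : Additive M →+ D := AddMonoidHom.mk' (fun m => ψ (1 : X) - ψ (m.toMul : X)) (by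
    intro a b
    have := hψm a.toMul b.toMul
    rw [toMul_add, Subgroup.coe_mul, this]
    abel)
  refine ⟨θ, fun n hn => ?_, ?_⟩
  · change ψ (1 : X) - ψ (n : X) = 0
    rw [(QuotientGroup.eq_one_iff n).2 hn, QuotientGroup.mk_one, sub_self]
  · refine sub_eq_zero.1 ((H2mk_eq_zero_iff (transgressionCocycle hM θ - f)).2
      ⟨fun p => -ψ (Quotient.out p : X), fun p q => ?_⟩)
    set s : X ⧸ M → X := Quotient.out with hs
    have hsec : ∀ p, ((s p : X) : X ⧸ M) = p := fun p => Quotient.out_eq' p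
    have hf := hψ (s p) (s q)
    rw [hsec, hsec] at hf
    have hm : s p * s q = s (p * q) * (sectionDefect M (s p * s q) : X) := by
      rw [Subgroup.mem_center_iff.1 (hM (sectionDefect M (s p * s q)).2)]
      change _ = s p * s q * (s (s p * s q : X))⁻¹ * s (p * q)
      rw [QuotientGroup.mk_mul, hsec, hsec, inv_mul_cancel_right]
    have h2 := hψm (s (p * q)) (sectionDefect M (s p * s q))
    rw [← hm] at h2
    change (ψ (1 : X) - ψ ((sectionDefect M (s p * s q) : X) : X)) -
      (f : X ⧸ M → X ⧸ M → D) p q = -ψ (s p) + -ψ (s q) - -ψ (s (p * q))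
    rw [hf, h2]
    abel

theorem map_eq_zero_of_mem_commutator (χ : Additive X →+ D) {x : X} (hx : x ∈ commutator X) :
    χ (.ofMul x) = 0 :=
  Abelianization.commutator_subset_ker (AddMonoidHom.toMultiplicativeRight χ) hx

end Transgression

section Extension

variable [DivisibleBy D ℤ]

theorem exists_comp_eq_of_ker_le {P Q : Type} [Group P] [CommGroup Q] (α : P →* Q)
    (θ : Additive P →+ D) (h : ∀ p, α p = 1 → θ (.ofMul p) = 0) :
    ∃ χ : Additive Q →+ D, ∀ p, χ (.ofMul (α p)) = θ (.ofMul p) := by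
  let a : Additive P →+ Additive Q := MonoidHom.toAdditive α
  let b : a.range →+ D := (AddMonoidHom.liftOfSurjective a.rangeRestrict
    a.rangeRestrict_surjective) ⟨θ, fun p hp => h p.toMul (congrArg Subtype.val hp)⟩
  obtain ⟨χ, hχ⟩ := (Module.Baer.of_divisible D).extension_property_addMonoidHom
    a.range.subtype Subtype.val_injective b
  refine ⟨χ, fun p => ?_⟩
  refine (DFunLike.congr_fun hχ (a.rangeRestrict (.ofMul p))).trans ?_
  exact AddMonoidHom.liftOfRightInverse_comp_apply _ _ _ _ _

theorem exists_comp_eq_of_le_center {X P : Type} [Group X] [Group P] {M : Subgroup X}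
    (hM : M ≤ Subgroup.center X) (α : P →* M) (hα : Function.Injective α)
    (θ : Additive P →+ D) : ∃ χ : Additive M →+ D, ∀ p, χ (.ofMul (α p)) = θ (.ofMul p) := by
  let _ : CommGroup M :=
    { mul_comm := fun a b => Subtype.ext (Subgroup.mem_center_iff.1 (hM b.2) a) }
  exact exists_comp_eq_of_ker_le α θ fun p hp => by
    rw [hα (hp.trans (map_one α).symm), ofMul_one, map_zero]

theorem exists_extension_of_vanishing {X : Type} [Group X] {M : Subgroup X}
    (θ : Additive M →+ D) (h : ∀ m : M, (m : X) ∈ commutator X → θ (.ofMul m) = 0) :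
    ∃ χ : Additive X →+ D, ∀ m : M, χ (.ofMul (m : X)) = θ (.ofMul m) := by
  obtain ⟨χ, hχ⟩ := exists_comp_eq_of_ker_le (Abelianization.of.comp M.subtype) θ fun m hm =>
    h m (by rwa [← Abelianization.ker_of, MonoidHom.mem_ker])
  exact ⟨χ.comp (MonoidHom.toAdditive Abelianization.of), hχ⟩

end Extension

theorem exists_injective_of_ker_eq {S A B : Type} [AddCommGroup S] [AddCommGroup A]
    [AddCommGroup B] (f : S →+ A) (g : S →+ B) (hg : Function.Surjective g)
    (h : ∀ s, f s = 0 ↔ g s = 0) :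
    ∃ e : B →+ A, Function.Injective e ∧ ∀ s, e (g s) = f s := by
  let e : B →+ A := AddMonoidHom.liftOfSurjective g hg ⟨f, fun s hs => (h s).2 hs⟩
  have he : ∀ s, e (g s) = f s := fun s => AddMonoidHom.liftOfRightInverse_comp_apply _ _ _ _ _
  refine ⟨e, (injective_iff_map_eq_zero e).2 fun b hb => ?_, he⟩
  obtain ⟨s, rfl⟩ := hg b
  exact (h s).1 ((he s).symm.trans hb)

section Embedding

variable {X P : Type} [Group X] [Group P] {N M : Subgroup X} [N.Normal] [M.Normal]
  [DivisibleBy D ℤ]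

theorem ker_inflMap_equiv (h : N ≤ M) (hM : M ≤ Subgroup.center X) (hN : N ≤ commutator X)
    (α : P →* X) (hα : Function.Injective α) (hrange : α.range = M ⊓ commutator X)
    (N' : Subgroup P) [N'.Normal] (hN' : N' = N.comap α) :
    Nonempty ((inflMap h D).ker ≃+ (Additive (P ⧸ N') →+ D)) := by
  have hmem : ∀ p, α p ∈ M ⊓ commutator X := fun p => hrange ▸ ⟨p, rfl⟩
  let β : P →* M := α.codRestrict M fun p => (hmem p).1
  have hβ : Function.Injective β := fun p q hpq => hα (congrArg Subtype.val hpq)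
  let γ : P ⧸ N' →* M ⧸ N.subgroupOf M := QuotientGroup.map _ _ β (by rw [hN']; exact le_rfl)
  let f : (Additive (M ⧸ N.subgroupOf M) →+ D) →+ H2 (X ⧸ M) D :=
    (transgression hM).comp (AddMonoidHom.compHom'
      (MonoidHom.toAdditive (QuotientGroup.mk' (N.subgroupOf M))))
  let g : (Additive (M ⧸ N.subgroupOf M) →+ D) →+ (Additive (P ⧸ N') →+ D) :=
    AddMonoidHom.compHom' (MonoidHom.toAdditive γ)
  have hlift : ∀ θ : Additive M →+ D, (∀ n (hn : n ∈ N), θ (.ofMul ⟨n, h hn⟩) = 0) →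
      ∃ σ : Additive (M ⧸ N.subgroupOf M) →+ D,
        ∀ m : M, σ (.ofMul (m : M ⧸ N.subgroupOf M)) = θ (.ofMul m) := fun θ hθ =>
    ⟨MonoidHom.toAdditiveLeft (QuotientGroup.lift (N.subgroupOf M)
      (AddMonoidHom.toMultiplicativeRight θ) fun m hm => hθ m hm), fun m => rfl⟩
  have hg : Function.Surjective g := by
    intro τ
    obtain ⟨χ, hχ⟩ := exists_comp_eq_of_le_center hM β hβ
      (τ.comp (MonoidHom.toAdditive (QuotientGroup.mk' N')))
    obtain ⟨σ, hσ⟩ := hlift χ fun n hn => by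
      obtain ⟨p, rfl⟩ : n ∈ α.range := hrange ▸ ⟨h hn, hN hn⟩
      have hp : (p : P ⧸ N') = 1 := (QuotientGroup.eq_one_iff p).2 (by rw [hN']; exact hn)
      refine (hχ p).trans ?_
      change τ (.ofMul (p : P ⧸ N')) = 0
      rw [hp, ofMul_one, map_zero]
    refine ⟨σ, AddMonoidHom.ext fun q => ?_⟩
    obtain ⟨p, hp⟩ := QuotientGroup.mk_surjective q.toMul
    obtain rfl : q = .ofMul (p : P ⧸ N') := congrArg Additive.ofMul hp.symm
    exact (hσ (β p)).trans (hχ p)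
  have hker : ∀ σ, f σ = 0 ↔ g σ = 0 := by
    intro σ
    rw [← inflMap_refl_apply (f σ)]
    refine (inflMap_transgression_eq_zero_iff (le_refl M) hM _).trans ⟨?_, fun hσ => ?_⟩
    · rintro ⟨χ, hχ⟩
      refine AddMonoidHom.ext fun q => ?_
      obtain ⟨p, hp⟩ := QuotientGroup.mk_surjective q.toMul
      obtain rfl : q = .ofMul (p : P ⧸ N') := congrArg Additive.ofMul hp.symm
      exact (hχ _ (hmem p).1).trans (map_eq_zero_of_mem_commutator χ (hmem p).2)
    · obtain ⟨χ, hχ⟩ := exists_extension_of_vanishing (σ.comp (MonoidHom.toAdditive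
        (QuotientGroup.mk' (N.subgroupOf M)))) fun m hm => by
          obtain ⟨p, hp⟩ : (m : X) ∈ α.range := hrange ▸ ⟨m.2, hm⟩
          obtain rfl : β p = m := Subtype.ext hp
          exact DFunLike.congr_fun hσ (.ofMul (p : P ⧸ N'))
      exact ⟨χ, fun n hn => (hχ ⟨n, hn⟩).symm⟩
  obtain ⟨e, he, hcomp⟩ := exists_injective_of_ker_eq f g hg hker
  have hrange_e : e.range = (inflMap h D).ker := by
    ext c
    constructor
    · rintro ⟨τ, rfl⟩
      obtain ⟨σ, rfl⟩ := hg τ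
      rw [hcomp]
      refine (inflMap_transgression_eq_zero_iff h hM _).2 ⟨0, fun n hn => ?_⟩
      have hn1 : ((⟨n, h hn⟩ : M) : M ⧸ N.subgroupOf M) = 1 := (QuotientGroup.eq_one_iff _).2 hn
      change σ (.ofMul ((⟨n, h hn⟩ : M) : M ⧸ N.subgroupOf M)) = 0
      rw [hn1, ofMul_one, map_zero]
    · intro hc
      obtain ⟨θ, hθ, rfl⟩ := exists_transgression_eq h hM hc
      obtain ⟨σ, hσ⟩ := hlift θ hθ
      refine ⟨g σ, (hcomp σ).trans (congrArg (transgression hM) (AddMonoidHom.ext fun m => ?_))⟩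
      exact hσ m.toMul
  exact ⟨((AddMonoidHom.ofInjective he).trans (AddEquiv.addSubgroupCongr hrange_e)).symm⟩

theorem exists_hom_embedding (h : N ≤ M) (hM : M ≤ Subgroup.center X) (hN : N ≤ commutator X)
    (α : P →* X) (hα : Function.Injective α) (hrange : α.range = N) :
    ∃ e : (Additive P →+ D) →+ H2 (X ⧸ M) D ⧸ (inflMap h D).ker, Function.Injective e := by
  have hmem : ∀ p, α p ∈ N := fun p => hrange ▸ ⟨p, rfl⟩
  let β : P →* M := α.codRestrict M fun p => h (hmem p)
  have hβ : Function.Injective β := fun p q hpq => hα (congrArg Subtype.val hpq)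
  obtain ⟨e, he, -⟩ := exists_injective_of_ker_eq
    ((QuotientAddGroup.mk' (inflMap h D).ker).comp (transgression hM))
    (AddMonoidHom.compHom' (MonoidHom.toAdditive β))
    (fun τ => (exists_comp_eq_of_le_center hM β hβ τ).imp fun χ hχ => AddMonoidHom.ext hχ)
    fun θ => by
      refine (QuotientAddGroup.eq_zero_iff _).trans
        ((inflMap_transgression_eq_zero_iff h hM θ).trans ⟨?_, fun hθ => ⟨0, fun n hn => ?_⟩⟩)
      · rintro ⟨χ, hχ⟩
        exact AddMonoidHom.ext fun p => (hχ _ (hmem p.toMul)).trans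
          (map_eq_zero_of_mem_commutator χ (hN (hmem p.toMul)))
      · obtain ⟨p, rfl⟩ : n ∈ α.range := hrange ▸ hn
        exact DFunLike.congr_fun hθ (.ofMul p)
  exact ⟨e, he⟩

end Embedding

theorem mem_commutator_coe_iff {X : Type} [Group X] (H : Subgroup X) {x : H} :
    x ∈ commutator H ↔ (x : X) ∈ ⁅H, H⁆ := by
  rw [← Subgroup.map_subtype_commutator]
  exact (Subgroup.mem_map_iff_mem Subtype.val_injective).symm

/-- With `L`, `M` the kernels of the inflation maps `H²(H/A, D) → H²(H/Z, D)` and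
`H²(K/A, D) → H²(K/Z, D)` (so `L ≅ Hom((A ∩ H')/Z, D)` and `M ≅ Hom((A ∩ K')/Z, D)`),
`Hom(Z, D)` embeds into `(H²(H/A, D)/L) ⊕ (H²(K/A, D)/M)`. -/
theorem homZ_embeds_in_images {G : Type} [Group G] (H K : Subgroup G) [H.Normal] [K.Normal]
    (hprod : H ⊔ K = ⊤) (hcomm : ∀ h ∈ H, ∀ k ∈ K, Commute h k)
    (D : Type) [AddCommGroup D] [DivisibleBy D ℤ]
    [((H ⊓ K).subgroupOf H).Normal] [((H ⊓ K).subgroupOf K).Normal]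
    [((⁅H, H⁆ ⊓ ⁅K, K⁆).subgroupOf H).Normal] [((⁅H, H⁆ ⊓ ⁅K, K⁆).subgroupOf K).Normal]
    [((⁅H, H⁆ ⊓ ⁅K, K⁆).subgroupOf (H ⊓ K ⊓ ⁅H, H⁆)).Normal]
    [((⁅H, H⁆ ⊓ ⁅K, K⁆).subgroupOf (H ⊓ K ⊓ ⁅K, K⁆)).Normal] :
    let L := AddMonoidHom.ker (inflMap (subgroupOf_le (inf_commutator_le_inf H K) H) D)
    let M := AddMonoidHom.ker (inflMap (subgroupOf_le (inf_commutator_le_inf H K) K) D)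
    Nonempty (↥L ≃+
      (Additive (↥(H ⊓ K ⊓ ⁅H, H⁆) ⧸ (⁅H, H⁆ ⊓ ⁅K, K⁆).subgroupOf (H ⊓ K ⊓ ⁅H, H⁆)) →+ D)) ∧
    Nonempty (↥M ≃+
      (Additive (↥(H ⊓ K ⊓ ⁅K, K⁆) ⧸ (⁅H, H⁆ ⊓ ⁅K, K⁆).subgroupOf (H ⊓ K ⊓ ⁅K, K⁆)) →+ D)) ∧
    ∃ ι : (Additive ↥(⁅H, H⁆ ⊓ ⁅K, K⁆) →+ D) →+
        ((H2 (↥H ⧸ (H ⊓ K).subgroupOf H) D ⧸ L) × (H2 (↥K ⧸ (H ⊓ K).subgroupOf K) D ⧸ M)),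
      Function.Injective ι := by
  have hA_H : (H ⊓ K).subgroupOf H ≤ Subgroup.center H := fun x hx =>
    Subgroup.mem_center_iff.2 fun y => Subtype.ext (hcomm y y.2 x hx.2)
  have hA_K : (H ⊓ K).subgroupOf K ≤ Subgroup.center K := fun x hx =>
    Subgroup.mem_center_iff.2 fun y => Subtype.ext (hcomm x hx.1 y y.2).symm
  have hZ_H : (⁅H, H⁆ ⊓ ⁅K, K⁆).subgroupOf H ≤ commutator H := fun x hx =>
    (mem_commutator_coe_iff H).2 hx.1
  have hZ_K : (⁅H, H⁆ ⊓ ⁅K, K⁆).subgroupOf K ≤ commutator K := fun x hx =>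
    (mem_commutator_coe_iff K).2 hx.2
  refine ⟨?_, ?_, ?_⟩
  · refine ker_inflMap_equiv _ hA_H hZ_H
      (Subgroup.inclusion (inf_le_left.trans inf_le_left : H ⊓ K ⊓ ⁅H, H⁆ ≤ H))
      (Subgroup.inclusion_injective _) ?_ _ rfl
    ext x
    rw [Subgroup.inclusion_range, Subgroup.mem_inf, mem_commutator_coe_iff]
    rfl
  · refine ker_inflMap_equiv _ hA_K hZ_K
      (Subgroup.inclusion (inf_le_left.trans inf_le_right : H ⊓ K ⊓ ⁅K, K⁆ ≤ K))
      (Subgroup.inclusion_injective _) ?_ _ rfl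
    ext x
    rw [Subgroup.inclusion_range, Subgroup.mem_inf, mem_commutator_coe_iff]
    rfl
  · obtain ⟨e, he⟩ := exists_hom_embedding (D := D)
      (subgroupOf_le (inf_commutator_le_inf H K) H) hA_H hZ_H
      (Subgroup.inclusion (inf_le_left.trans (commutator_le_self H) : ⁅H, H⁆ ⊓ ⁅K, K⁆ ≤ H))
      (Subgroup.inclusion_injective _) (Subgroup.inclusion_range _)
    exact ⟨e.prod 0, fun a b hab => he (congrArg Prod.fst hab)⟩

end SchurCP
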